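/- arXiv:2301.12897 — 2 statements merged into one kernel-verified Lean document; each statement's English description precedes it below -/
import Mathlib

section
/- Let C be the projective variety in \u2119\u00b3 cut out by the two homogeneous polynomials XY + ZT and X\u00b2Z + Y\u00b2Z + YZ\u00b2 + X\u00b2T + Y\u00b2T + XT\u00b2 (with coefficients 0,1). Then: for every finite field K with |K| = 2, C has exactly 7 K-points; for every finite field K with |K| = 4, C has exactly 9 K-points; for every finite field K with |K| = 8, C has exactly 13 K-points; and for every finite field K with |K| = 16, C has exactly 9 K-points. -/
open MvPolynomial

/-- The quadric `XY + ZT` in `ℙ³`. -/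
noncomputable def quadF (K : Type) [Field K] : MvPolynomial (Fin 4) K :=
  X 0 * X 1 + X 2 * X 3

/-- The cubic `X²Z + Y²Z + YZ² + X²T + Y²T + XT²`. -/
noncomputable def cubicG (K : Type) [Field K] : MvPolynomial (Fin 4) K :=
  X 0 ^ 2 * X 2 + X 1 ^ 2 * X 2 + X 1 * X 2 ^ 2 + X 0 ^ 2 * X 3 + X 1 ^ 2 * X 3 + X 0 * X 3 ^ 2

/-- The set of `K`-points of the projective variety `V(f, g) ⊆ ℙ³`. -/
def projPoints (K : Type) [Field K] (f g : MvPolynomial (Fin 4) K) : Type :=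
  {p : Projectivization K (Fin 4 → K) //
    MvPolynomial.eval p.rep f = 0 ∧ MvPolynomial.eval p.rep g = 0}

theorem eval_iff (K : Type) [Field K] (v : Fin 4 → K) (hv : v ≠ 0) :
    (MvPolynomial.eval (Projectivization.mk K v hv).rep (quadF K) = 0 ∧
      MvPolynomial.eval (Projectivization.mk K v hv).rep (cubicG K) = 0) ↔
    (v 0 * v 1 + v 2 * v 3 = 0 ∧
      v 0 ^ 2 * v 2 + v 1 ^ 2 * v 2 + v 1 * v 2 ^ 2 + v 0 ^ 2 * v 3 + v 1 ^ 2 * v 3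
        + v 0 * v 3 ^ 2 = 0) := by
  obtain ⟨a, ha⟩ := Projectivization.exists_smul_eq_mk_rep K v hv
  rw [← ha]
  have ha0 : (a : K) ≠ 0 := a.ne_zero
  have e1 : MvPolynomial.eval (a • v) (quadF K) = (a : K) ^ 2 * (v 0 * v 1 + v 2 * v 3) := by
    simp [quadF, Units.smul_def]; ring
  have e2 : MvPolynomial.eval (a • v) (cubicG K) = (a : K) ^ 3 *
      (v 0 ^ 2 * v 2 + v 1 ^ 2 * v 2 + v 1 * v 2 ^ 2 + v 0 ^ 2 * v 3 + v 1 ^ 2 * v 3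
        + v 0 * v 3 ^ 2) := by
    simp [cubicG, Units.smul_def]; ring
  rw [e1, e2]
  simp [ha0]

/-- The affine equation of the curve in the chart `X = 1`. -/
def hpoly {K : Type} [Add K] [Mul K] (z t : K) : K :=
  z + t + t * t + z * z * t * (z * t + z + t * t)

/-- Representatives of the points. -/
def repv {K : Type} [Field K] : ({p : K × K // hpoly p.1 p.2 = 0} ⊕ Fin 4) → Fin 4 → K
  | Sum.inl p => ![1, p.1.1 * p.1.2, p.1.1, p.1.2]
  | Sum.inr 0 => ![0, 0, 1, 0]
  | Sum.inr 1 => ![0, 0, 0, 1]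
  | Sum.inr 2 => ![0, 1, 0, 0]
  | Sum.inr 3 => ![0, 1, 1, 0]

theorem repv_ne {K : Type} [Field K] (s : {p : K × K // hpoly p.1 p.2 = 0} ⊕ Fin 4) :
    repv s ≠ 0 := by
  intro h
  have h0 := congrFun h 0
  have h1 := congrFun h 1
  have h2 := congrFun h 2
  have h3 := congrFun h 3
  rcases s with p | i
  · simp [repv] at h0
  · fin_cases i <;> simp [repv] at h0 h1 h2 h3

theorem repv_inj {K : Type} [Field K] (s s' : {p : K × K // hpoly p.1 p.2 = 0} ⊕ Fin 4)
    (a : K) (h : a • repv s' = repv s) : s = s' := by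
  have h0 := congrFun h 0
  have h1 := congrFun h 1
  have h2 := congrFun h 2
  have h3 := congrFun h 3
  rcases s with ⟨⟨z, t⟩, hp⟩ | i <;> rcases s' with ⟨⟨z', t'⟩, hp'⟩ | j
  · simp [repv] at h0 h1 h2 h3
    subst h0
    simp_all
  · fin_cases j <;> simp [repv] at h0
  · fin_cases i <;> simp [repv] at h0 h1 h2 h3 <;> simp_all
  · fin_cases i <;> fin_cases j <;> simp [repv] at h0 h1 h2 h3 <;> simp_all

theorem card_points (K : Type) [Field K] [Finite K] (hc : (2 : K) = 0) :
    Nat.card (projPoints K (quadF K) (cubicG K)) =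
      Nat.card {p : K × K // hpoly p.1 p.2 = 0} + 4 := by
  have hcc : ∀ x : K, x + x = 0 := fun x => by linear_combination x * hc
  have key : ∀ s : {p : K × K // hpoly p.1 p.2 = 0} ⊕ Fin 4,
      MvPolynomial.eval (Projectivization.mk K (repv s) (repv_ne s)).rep (quadF K) = 0 ∧
      MvPolynomial.eval (Projectivization.mk K (repv s) (repv_ne s)).rep (cubicG K) = 0 := by
    intro s
    rw [eval_iff]
    rcases s with ⟨⟨z, t⟩, hp⟩ | i
    · simp only [hpoly] at hp
      simp only [repv, Matrix.cons_val]
      refine ⟨by linear_combination z * t * hc, by linear_combination hp⟩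
    · fin_cases i <;> simp [repv, hcc]
  let F : ({p : K × K // hpoly p.1 p.2 = 0} ⊕ Fin 4) → projPoints K (quadF K) (cubicG K) :=
    fun s => ⟨Projectivization.mk K (repv s) (repv_ne s), key s⟩
  have hF : Function.Bijective F := by
    constructor
    · intro s s' h
      have h' := congrArg Subtype.val h
      obtain ⟨a, ha⟩ := (Projectivization.mk_eq_mk_iff' K _ _ (repv_ne s) (repv_ne s')).1 h'
      exact repv_inj s s' a ha
    · rintro ⟨p, hp⟩
      induction p using Projectivization.ind with
      | h v hv =>
      rw [eval_iff] at hp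
      suffices hs : ∃ s, ∃ a : K, a • v = repv s by
        obtain ⟨s, a, ha⟩ := hs
        exact ⟨s, Subtype.ext ((Projectivization.mk_eq_mk_iff' K _ _ _ _).2 ⟨a, ha⟩)⟩
      obtain ⟨hq, hg⟩ := hp
      have hne : ¬ (v 0 = 0 ∧ v 1 = 0 ∧ v 2 = 0 ∧ v 3 = 0) := by
        rintro ⟨h0, h1, h2, h3⟩
        apply hv
        ext i
        fin_cases i <;> simp [*]
      generalize hx : v 0 = x at *
      generalize hy : v 1 = y at *
      generalize hz : v 2 = z at *
      generalize ht : v 3 = t at *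
      have hvv : v = ![x, y, z, t] := by
        ext i; fin_cases i <;> simp [*]
      rw [hvv]
      by_cases x0 : x = 0
      · subst x0
        by_cases y0 : y = 0
        · subst y0
          have hzt : z = 0 ∨ t = 0 := by simpa using hq
          rcases hzt with rfl | rfl
          · have t0 : t ≠ 0 := by simpa using hne
            exact ⟨Sum.inr 1, t⁻¹, by simp [repv, t0]⟩
          · have z0 : z ≠ 0 := by simpa using hne
            exact ⟨Sum.inr 0, z⁻¹, by simp [repv, z0]⟩
        · have hzt : z = 0 ∨ t = 0 := by simpa using hq
          rcases hzt with rfl | rfl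
          · have t0 : t = 0 := by simpa [y0] using hg
            subst t0
            exact ⟨Sum.inr 2, y⁻¹, by simp [repv, y0]⟩
          · by_cases z0 : z = 0
            · subst z0
              exact ⟨Sum.inr 2, y⁻¹, by simp [repv, y0]⟩
            · have e : y * z * (y + z) = 0 := by linear_combination hg
              have e2 : y + z = 0 := by simpa [y0, z0] using e
              have e3 : z = y := by linear_combination e2 - y * hc
              subst e3
              exact ⟨Sum.inr 3, z⁻¹, by simp [repv, y0]⟩
      · have ey : y = x⁻¹ * z * t := by
          field_simp
          linear_combination hq - z * t * hc
        refine ⟨Sum.inl ⟨(x⁻¹ * z, x⁻¹ * t), ?_⟩, x⁻¹, ?_⟩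
        · subst ey
          simp only [hpoly]
          field_simp
          field_simp at hg
          linear_combination hg
        · subst ey
          simp [repv, x0]
          ring
  rw [← Nat.card_congr (Equiv.ofBijective F hF), Nat.card_sum]
  simp

theorem card_transfer (K M : Type) [Field K] [Fintype K] [Field M] [Fintype M] [DecidableEq M]
    (h : Fintype.card K = Fintype.card M) (hc : (2 : M) = 0) (n : ℕ)
    (hn : Fintype.card {p : M × M // hpoly p.1 p.2 = 0} = n) :
    Nat.card (projPoints K (quadF K) (cubicG K)) = n + 4 := by
  let e : K ≃+* M := FiniteField.ringEquivOfCardEq h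
  have hcK : (2 : K) = 0 := by
    apply e.injective
    rw [map_zero, map_ofNat, hc]
  rw [card_points K hcK, ← hn, ← Nat.card_eq_fintype_card]
  congr 1
  refine Nat.card_congr ((Equiv.prodCongr e.toEquiv e.toEquiv).subtypeEquiv ?_)
  rintro ⟨z, t⟩
  rw [← e.injective.eq_iff]
  simp [hpoly]

/-- Carryless multiplication modulo the polynomial coded by `p`, of degree `k`. -/
def cmul (q p : ℕ) : ℕ → ℕ → ℕ → ℕ
  | 0, _, _ => 0
  | n + 1, a, b => (b % 2 * a) ^^^
      cmul q p n ((2 * a) ^^^ (2 * a / q * p)) (b / 2)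

/-- The binary field model with `2 ^ k` elements, for the modulus coded by `p`. -/
structure BF (k p : ℕ) where
  /-- the underlying code -/
  val : Fin (2 ^ k)

namespace BF
variable {k p : ℕ}

instance : DecidableEq (BF k p) := fun a b =>
  decidable_of_iff (a.val = b.val)
    ⟨fun h => by cases a; cases b; cases h; rfl, fun h => congrArg BF.val h⟩

/-- Codes. -/
def equiv (k p : ℕ) : BF k p ≃ Fin (2 ^ k) := ⟨BF.val, BF.mk, fun _ => rfl, fun _ => rfl⟩

instance : Fintype (BF k p) := Fintype.ofEquiv _ (equiv k p).symm

theorem card : Fintype.card (BF k p) = 2 ^ k := by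
  rw [Fintype.card_congr (equiv k p), Fintype.card_fin]

/-- The element with given code. -/
def of (n : ℕ) : BF k p := ⟨⟨n % 2 ^ k, Nat.mod_lt _ (by positivity)⟩⟩
instance : Zero (BF k p) := ⟨of 0⟩
instance : One (BF k p) := ⟨of 1⟩
instance : Add (BF k p) := ⟨fun a b => of (a.val.1 ^^^ b.val.1)⟩
instance : Neg (BF k p) := ⟨fun a => a⟩
instance : Mul (BF k p) := ⟨fun a b => of (cmul (2 ^ k) p k a.val.1 b.val.1)⟩

/-- Multiplicative inverse as the power `2 ^ k - 2`. -/
def invAux (a : BF k p) : ℕ → BF k p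
  | 0 => 1
  | n + 1 => a * invAux a n
instance : Inv (BF k p) := ⟨fun a => if a = 0 then 0 else invAux a (2 ^ k - 2)⟩

theorem forall_iff (P : BF k p → Prop) : (∀ a, P a) ↔ ∀ i : Fin (2 ^ k), P ⟨i⟩ :=
  ⟨fun h i => h ⟨i⟩, fun h a => h a.val⟩

/-- The finitely many identities that make the model a field. -/
structure Good (k p : ℕ) : Prop where
  add_assoc : ∀ a b c : BF k p, a + b + c = a + (b + c)
  add_comm : ∀ a b : BF k p, a + b = b + a
  zero_add : ∀ a : BF k p, 0 + a = a
  add_self : ∀ a : BF k p, a + a = 0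
  mul_assoc : ∀ a b c : BF k p, a * b * c = a * (b * c)
  mul_comm : ∀ a b : BF k p, a * b = b * a
  one_mul : ∀ a : BF k p, 1 * a = a
  mul_add : ∀ a b c : BF k p, a * (b + c) = a * b + a * c
  zero_mul : ∀ a : BF k p, 0 * a = 0
  one_ne : (0 : BF k p) ≠ 1
  mul_inv : ∀ a : BF k p, a ≠ 0 → a * a⁻¹ = 1
  inv_zero : (0 : BF k p)⁻¹ = 0

/-- The field structure. -/
abbrev toField (h : Good k p) : Field (BF k p) where
  add_assoc := h.add_assoc
  add_comm := h.add_comm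
  zero_add := h.zero_add
  add_zero a := by rw [h.add_comm, h.zero_add]
  neg_add_cancel a := h.add_self a
  mul_assoc := h.mul_assoc
  mul_comm := h.mul_comm
  one_mul := h.one_mul
  mul_one a := by rw [h.mul_comm, h.one_mul]
  left_distrib := h.mul_add
  right_distrib a b c := by rw [h.mul_comm, h.mul_add, h.mul_comm c a, h.mul_comm c b]
  zero_mul := h.zero_mul
  mul_zero a := by rw [h.mul_comm, h.zero_mul]
  exists_pair_ne := ⟨0, 1, h.one_ne⟩
  mul_inv_cancel := h.mul_inv
  inv_zero := h.inv_zero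
  nsmul := nsmulRec
  zsmul := zsmulRec
  nnqsmul := _
  nnqsmul_def := fun _ _ => rfl
  qsmul := _
  qsmul_def := fun _ _ => rfl

theorem count (h : Good k p) (n : ℕ)
    (hn : Fintype.card {x : BF k p × BF k p // hpoly x.1 x.2 = 0} = n)
    (K : Type) [Field K] [Fintype K] (hK : Fintype.card K = 2 ^ k) :
    Nat.card (projPoints K (quadF K) (cubicG K)) = n + 4 := by
  let _ := toField h
  refine card_transfer K (BF k p) (hK.trans card.symm) ?_ n hn
  rw [← one_add_one_eq_two]
  exact h.add_self 1

theorem good1 : Good 1 2 := by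
  constructor <;> (try simp only [forall_iff]) <;> decide +kernel
theorem good2 : Good 2 7 := by
  constructor <;> (try simp only [forall_iff]) <;> decide +kernel
theorem good3 : Good 3 11 := by
  constructor <;> (try simp only [forall_iff]) <;> decide +kernel
theorem good4 : Good 4 19 := by
  constructor <;> (try simp only [forall_iff]) <;> decide +kernel
end BF

theorem stmt0 :
    (∀ (K : Type) [Field K] [Fintype K], Fintype.card K = 2 →
      Nat.card (projPoints K (quadF K) (cubicG K)) = 7) ∧
    (∀ (K : Type) [Field K] [Fintype K], Fintype.card K = 4 →
      Nat.card (projPoints K (quadF K) (cubicG K)) = 9) ∧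
    (∀ (K : Type) [Field K] [Fintype K], Fintype.card K = 8 →
      Nat.card (projPoints K (quadF K) (cubicG K)) = 13) ∧
    (∀ (K : Type) [Field K] [Fintype K], Fintype.card K = 16 →
      Nat.card (projPoints K (quadF K) (cubicG K)) = 9) := by
  refine ⟨?_, ?_, ?_, ?_⟩
  · intro K _ _ hK
    exact BF.count BF.good1 3 (by decide +kernel) K hK
  · intro K _ _ hK
    exact BF.count BF.good2 5 (by decide +kernel) K hK
  · intro K _ _ hK
    exact BF.count BF.good3 9 (by decide +kernel) K hK
  · intro K _ _ hK
    exact BF.count BF.good4 5 (by decide +kernel) K hK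
end

section
/- Let k be an algebraically closed field of characteristic 2, and let q\u2080 \u2208 k[X,Y,Z,T] be a homogeneous cubic such that the projective variety V(XY+ZT, q\u2080) is smooth, i.e., at every nonzero vector p \u2208 k\u2074 with (XY+ZT)(p) = q\u2080(p) = 0 the 2\u00d74 Jacobian matrix of (XY+ZT, q\u2080) at p has rank exactly 2. Then there exist an invertible linear change of coordinates A \u2208 GL\u2084(k) and a constant c \u2208 k\u02e3 with (XY+ZT)\u2218A = c\u00b7(XY+ZT), a scalar \u03bb \u2208 k\u02e3, a homogeneous linear form L \u2208 k[X,Y,Z,T], and coefficients a_{ij} \u2208 k, such that q\u2080\u2218A = \u03bb\u00b7q + L\u00b7(XY+ZT), where q is a cubic of form a) or of form b). -/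
open MvPolynomial

/-- Cubic of form a). -/
noncomputable def cubicA (k : Type*) [Field k]
    (a21 a31 a20 a12 a22 a11 a32 a10 a13 a02 a23 a01 : k) : MvPolynomial (Fin 4) k :=
  X 0 ^ 3 + X 1 ^ 3 + C a21 * (X 0 ^ 2 * X 1) + C a31 * (X 0 ^ 2 * X 2) +
    C a20 * (X 0 ^ 2 * X 3) + C a12 * (X 0 * X 1 ^ 2) + C a22 * (X 0 * X 1 * X 2) +
    C a11 * (X 0 * X 1 * X 3) + C a32 * (X 0 * X 2 ^ 2) + C a10 * (X 0 * X 3 ^ 2) +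
    C a13 * (X 1 ^ 2 * X 2) + C a02 * (X 1 ^ 2 * X 3) + C a23 * (X 1 * X 2 ^ 2) +
    C a01 * (X 1 * X 3 ^ 2)

/-- Cubic of form b): as form a) but without the `Y³` term. -/
noncomputable def cubicB (k : Type*) [Field k]
    (a21 a31 a20 a12 a22 a11 a32 a10 a13 a02 a23 a01 : k) : MvPolynomial (Fin 4) k :=
  X 0 ^ 3 + C a21 * (X 0 ^ 2 * X 1) + C a31 * (X 0 ^ 2 * X 2) +
    C a20 * (X 0 ^ 2 * X 3) + C a12 * (X 0 * X 1 ^ 2) + C a22 * (X 0 * X 1 * X 2) +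
    C a11 * (X 0 * X 1 * X 3) + C a32 * (X 0 * X 2 ^ 2) + C a10 * (X 0 * X 3 ^ 2) +
    C a13 * (X 1 ^ 2 * X 2) + C a02 * (X 1 ^ 2 * X 3) + C a23 * (X 1 * X 2 ^ 2) +
    C a01 * (X 1 * X 3 ^ 2)

/-- The 2×4 Jacobian matrix of the pair `(f, q)` evaluated at the point `p ∈ k⁴`. -/
noncomputable def jacMat (k : Type*) [Field k] (f q : MvPolynomial (Fin 4) k)
    (p : Fin 4 → k) : Matrix (Fin 2) (Fin 4) k :=
  Matrix.of ![fun j => MvPolynomial.eval p (MvPolynomial.pderiv j f),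
              fun j => MvPolynomial.eval p (MvPolynomial.pderiv j q)]

/-- The linear substitution of variables `Xᵢ ↦ ∑ⱼ Aᵢⱼ Xⱼ` applied to `q`, i.e. `q ∘ A`. -/
noncomputable def substLin (k : Type*) [Field k] (A : Matrix (Fin 4) (Fin 4) k)
    (q : MvPolynomial (Fin 4) k) : MvPolynomial (Fin 4) k :=
  MvPolynomial.aeval (fun i => ∑ j, C (A i j) * X j) q

namespace Stmt8Aux

variable {k : Type*} [Field k]

/-- Every cubic form is an explicit sum over triples of variables. -/
lemma cubic_expand (q : MvPolynomial (Fin 4) k) (hq : q.IsHomogeneous 3) :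
    ∃ c : Fin 4 → Fin 4 → Fin 4 → k,
      q = ∑ i, ∑ j, ∑ l, C (c i j l) * (X i * X j * X l) := by
  have key : ∀ s : Finset (Fin 4 →₀ ℕ), (∀ m ∈ s, m.degree = 3) →
      ∃ c : Fin 4 → Fin 4 → Fin 4 → k,
      ∑ m ∈ s, monomial m (coeff m q) = ∑ i, ∑ j, ∑ l, C (c i j l) * (X i * X j * X l) := by
    intro s
    induction s using Finset.induction_on with
    | empty => intro _; exact ⟨fun _ _ _ => 0, by simp⟩
    | insert m s hm ih =>
      intro h
      obtain ⟨c, hc⟩ := ih (fun m hm => h m (Finset.mem_insert_of_mem hm))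
      have hdeg := h m (Finset.mem_insert_self _ _)
      have hcard : Multiset.card (Finsupp.toMultiset m) = 3 := by
        rw [Finsupp.card_toMultiset, ← hdeg]; rfl
      obtain ⟨a, b, d, habd⟩ := Multiset.card_eq_three.1 hcard
      have hm' : m = Finsupp.single a 1 + Finsupp.single b 1 + Finsupp.single d 1 := by
        apply Multiset.toFinsupp.symm.injective
        change Finsupp.toMultiset m = Finsupp.toMultiset _
        rw [habd]
        simp [Finsupp.toMultiset_single]
      refine ⟨fun i j l => c i j l + (if i = a then if j = b then if l = d then coeff m q
        else 0 else 0 else 0), ?_⟩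
      rw [Finset.sum_insert hm, hc]
      have : (monomial m (coeff m q) : MvPolynomial (Fin 4) k)
          = C (coeff m q) * (X a * X b * X d) := by
        generalize coeff m q = r
        rw [hm']
        simp only [X, monomial_mul, C_mul_monomial, mul_one]
      rw [this]
      simp only [C_add, add_mul, Finset.sum_add_distrib, apply_ite (C : k → _), C_0,
        ite_mul, zero_mul]
      simp [add_comm]
  obtain ⟨c, hc⟩ := key q.support (by
    intro m hm
    have := hq (mem_support_iff.1 hm)
    rw [Finsupp.degree_eq_weight_one]; exact this)
  exact ⟨c, by rw [← hc]; exact q.as_sum⟩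

lemma substLin_homog (A : Matrix (Fin 4) (Fin 4) k) (q : MvPolynomial (Fin 4) k) (n : ℕ)
    (hq : q.IsHomogeneous n) : (substLin k A q).IsHomogeneous n := by
  have := hq.aeval (fun i => ∑ j, C (A i j) * X j) (n := 1) (by
    intro i
    apply IsHomogeneous.sum
    intro j _
    simpa using (isHomogeneous_C (Fin 4) (A i j)).mul (isHomogeneous_X k j))
  simpa [substLin] using this

lemma eval_substLin (A : Matrix (Fin 4) (Fin 4) k) (q : MvPolynomial (Fin 4) k)
    (p : Fin 4 → k) : eval p (substLin k A q) = eval (A.mulVec p) q := by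
  have : (eval p).comp (aeval (R := k) (fun i => ∑ j, C (A i j) * X j)
      : MvPolynomial (Fin 4) k →ₐ[k] MvPolynomial (Fin 4) k).toRingHom
      = eval (A.mulVec p) := by
    apply MvPolynomial.ringHom_ext
    · intro r; simp
    · intro i; simp [Matrix.mulVec, dotProduct]
  exact congrArg (fun φ => φ q) this

lemma substLin_comp (A B : Matrix (Fin 4) (Fin 4) k) (q : MvPolynomial (Fin 4) k) :
    substLin k A (substLin k B q) = substLin k (B * A) q := by
  have : ((aeval (R := k) (fun i => ∑ j, C (A i j) * X j)
      : MvPolynomial (Fin 4) k →ₐ[k] MvPolynomial (Fin 4) k)).comp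
      (aeval (fun i => ∑ j, C (B i j) * X j)) = aeval (fun i => ∑ j, C ((B * A) i j) * X j) := by
    apply MvPolynomial.algHom_ext
    intro i
    simp only [AlgHom.comp_apply, aeval_X, Matrix.mul_apply, Fin.sum_univ_four, map_add,
      map_mul, algHom_C, algebraMap_eq]
    ring
  exact congrArg (fun φ => φ q) this

/-- The quadric. -/
noncomputable def Q (k : Type*) [Field k] : MvPolynomial (Fin 4) k := X 0 * X 1 + X 2 * X 3

/-- The conclusion of the theorem for `q`. -/
def Good (q0 : MvPolynomial (Fin 4) k) : Prop :=
  ∃ (A : Matrix.GeneralLinearGroup (Fin 4) k) (c lam : kˣ)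
      (L : MvPolynomial (Fin 4) k), L.IsHomogeneous 1 ∧
      substLin k (A : Matrix (Fin 4) (Fin 4) k) (Q k) = C (c : k) * (Q k) ∧
      ∃ a21 a31 a20 a12 a22 a11 a32 a10 a13 a02 a23 a01 : k,
        (substLin k (A : Matrix (Fin 4) (Fin 4) k) q0 =
            C (lam : k) * cubicA k a21 a31 a20 a12 a22 a11 a32 a10 a13 a02 a23 a01 + L * (Q k) ∨
         substLin k (A : Matrix (Fin 4) (Fin 4) k) q0 =
            C (lam : k) * cubicB k a21 a31 a20 a12 a22 a11 a32 a10 a13 a02 a23 a01 + L * (Q k))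

lemma Good.of_subst (q : MvPolynomial (Fin 4) k) (B : Matrix (Fin 4) (Fin 4) k)
    (b : k) (hb : b ≠ 0) (hdet : B.det ≠ 0) (hB : substLin k B (Q k) = C b * Q k)
    (h : Good (substLin k B q)) : Good q := by
  obtain ⟨A, c, lam, L, hL, hA, a21, a31, a20, a12, a22, a11, a32, a10, a13, a02, a23, a01, h⟩ := h
  refine ⟨Matrix.GeneralLinearGroup.mkOfDetNeZero B hdet * A, Units.mk0 b hb * c, lam, L, hL, ?_,
    a21, a31, a20, a12, a22, a11, a32, a10, a13, a02, a23, a01, ?_⟩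
  · have : (Matrix.GeneralLinearGroup.mkOfDetNeZero B hdet : Matrix (Fin 4) (Fin 4) k) = B := rfl
    rw [Units.val_mul, this, ← substLin_comp, hB]
    have h2 : substLin k (A : Matrix (Fin 4) (Fin 4) k) (C b * Q k)
        = C b * substLin k (A : Matrix (Fin 4) (Fin 4) k) (Q k) := by
      simp [substLin, algebraMap_eq]
    rw [h2, hA]
    simp [mul_assoc]
  · have : (Matrix.GeneralLinearGroup.mkOfDetNeZero B hdet : Matrix (Fin 4) (Fin 4) k) = B := rfl
    rw [Units.val_mul, this, ← substLin_comp]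
    exact h

/-- Final normalisation when no rescaling is needed. -/
lemma good_base (q : MvPolynomial (Fin 4) k) (hq : q.IsHomogeneous 3)
    (h0 : eval ![1,0,0,0] q ≠ 0) (h2 : eval ![0,0,1,0] q = 0) (h3 : eval ![0,0,0,1] q = 0)
    (h1 : eval ![0,1,0,0] q = 0 ∨ eval ![0,1,0,0] q = eval ![1,0,0,0] q) : Good q := by
  obtain ⟨c, hc⟩ := cubic_expand q hq
  have e0 : eval ![1,0,0,0] q = c 0 0 0 := by rw [hc]; simp [Fin.sum_univ_four]
  have e1 : eval ![0,1,0,0] q = c 1 1 1 := by rw [hc]; simp [Fin.sum_univ_four]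
  have e2 : eval ![0,0,1,0] q = c 2 2 2 := by rw [hc]; simp [Fin.sum_univ_four]
  have e3 : eval ![0,0,0,1] q = c 3 3 3 := by rw [hc]; simp [Fin.sum_univ_four]
  rw [e0] at h0 h1
  rw [e1] at h1
  rw [e2] at h2
  rw [e3] at h3
  have hs : substLin k (1 : Matrix (Fin 4) (Fin 4) k) = id := by
    funext r
    have : (fun i : Fin 4 => ∑ j, C ((1 : Matrix (Fin 4) (Fin 4) k) i j) * X j)
        = (X : Fin 4 → MvPolynomial (Fin 4) k) := by
      funext i
      simp [Matrix.one_apply, apply_ite (C : k → MvPolynomial (Fin 4) k)]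
    simp [substLin, this]
  set l := c 0 0 0 with hl
  have hdiv : ∀ x : k, (C x : MvPolynomial (Fin 4) k) = C l * C (x / l) := by
    intro x
    rw [← C_mul, mul_div_cancel₀ _ h0]
  refine ⟨1, 1, Units.mk0 l h0,
    C (c 0 2 3 + c 0 3 2 + c 2 0 3 + c 2 3 0 + c 3 0 2 + c 3 2 0) * X 0
    + C (c 1 2 3 + c 1 3 2 + c 2 1 3 + c 2 3 1 + c 3 1 2 + c 3 2 1) * X 1
    + C (c 2 2 3 + c 2 3 2 + c 3 2 2) * X 2
    + C (c 3 3 2 + c 3 2 3 + c 2 3 3) * X 3, ?_, ?_,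
    (c 0 0 1 + c 0 1 0 + c 1 0 0
      - (c 0 2 3 + c 0 3 2 + c 2 0 3 + c 2 3 0 + c 3 0 2 + c 3 2 0)) / l,
    (c 0 0 2 + c 0 2 0 + c 2 0 0) / l,
    (c 0 0 3 + c 0 3 0 + c 3 0 0) / l,
    (c 1 1 0 + c 1 0 1 + c 0 1 1
      - (c 1 2 3 + c 1 3 2 + c 2 1 3 + c 2 3 1 + c 3 1 2 + c 3 2 1)) / l,
    (c 0 1 2 + c 0 2 1 + c 1 0 2 + c 1 2 0 + c 2 0 1 + c 2 1 0
      - (c 2 2 3 + c 2 3 2 + c 3 2 2)) / l,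
    (c 0 1 3 + c 0 3 1 + c 1 0 3 + c 1 3 0 + c 3 0 1 + c 3 1 0
      - (c 3 3 2 + c 3 2 3 + c 2 3 3)) / l,
    (c 2 2 0 + c 2 0 2 + c 0 2 2) / l,
    (c 3 3 0 + c 3 0 3 + c 0 3 3) / l,
    (c 1 1 2 + c 1 2 1 + c 2 1 1) / l,
    (c 1 1 3 + c 1 3 1 + c 3 1 1) / l,
    (c 2 2 1 + c 2 1 2 + c 1 2 2) / l,
    (c 3 3 1 + c 3 1 3 + c 1 3 3) / l, ?_⟩
  · have hX : ∀ (a : k) (i : Fin 4), (C a * X i : MvPolynomial (Fin 4) k).IsHomogeneous 1 := by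
      intro a i
      simpa using (isHomogeneous_C (Fin 4) a).mul (isHomogeneous_X k i)
    exact (((hX _ _).add (hX _ _)).add (hX _ _)).add (hX _ _)
  · simp [hs]
  · simp only [Units.val_one, hs, id, Units.val_mk0]
    rcases h1 with h1 | h1
    · right
      rw [hc]
      simp only [cubicB, Q, Fin.sum_univ_four, ← hl, h1, h2, h3, mul_add, ← mul_assoc, ← hdiv,
        C_add, C_sub, C_0]
      ring
    · left
      rw [hc]
      simp only [cubicA, Q, Fin.sum_univ_four, ← hl, h1, h2, h3, mul_add, ← mul_assoc, ← hdiv,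
        C_add, C_sub, C_0]
      ring

variable [IsAlgClosed k]

lemma good_scale (q : MvPolynomial (Fin 4) k) (hq : q.IsHomogeneous 3)
    (h0 : eval ![1,0,0,0] q ≠ 0) (h2 : eval ![0,0,1,0] q = 0) (h3 : eval ![0,0,0,1] q = 0) :
    Good q := by
  by_cases h1 : eval ![0,1,0,0] q = 0
  · exact good_base q hq h0 h2 h3 (Or.inl h1)
  obtain ⟨b, hb⟩ := IsAlgClosed.exists_pow_nat_eq (eval ![1,0,0,0] q / eval ![0,1,0,0] q)
    (n := 3) (by norm_num)
  have hb0 : b ≠ 0 := by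
    rintro rfl
    have := div_ne_zero h0 h1
    rw [← hb] at this
    simp at this
  have hsc : ∀ (v : Fin 4 → k), eval (b • v) q = b ^ 3 * eval v q := by
    intro v
    obtain ⟨c, hc⟩ := cubic_expand q hq
    rw [hc]
    simp only [map_sum, map_mul, eval_C, eval_X, Pi.smul_apply, smul_eq_mul, Finset.mul_sum]
    refine Finset.sum_congr rfl fun i _ => Finset.sum_congr rfl fun j _ =>
      Finset.sum_congr rfl fun l _ => by ring
  apply Good.of_subst q (Matrix.of ![![1,0,0,0],![0,b,0,0],![0,0,b,0],![0,0,0,1]]) b hb0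
  · simp [Matrix.det_succ_row_zero, Fin.sum_univ_succ, Fin.succAbove, hb0]
  · simp [substLin, Q, Fin.sum_univ_four]
    ring
  · have m0 : (Matrix.of ![![1,0,0,0],![0,b,0,0],![0,0,b,0],![0,0,0,1]]).mulVec ![1,0,0,0]
        = ![1,0,0,0] := by
      funext i; fin_cases i <;> simp [Matrix.mulVec, dotProduct, Fin.sum_univ_four]
    have m1 : (Matrix.of ![![1,0,0,0],![0,b,0,0],![0,0,b,0],![0,0,0,1]]).mulVec ![0,1,0,0]
        = b • ![0,1,0,0] := by
      funext i; fin_cases i <;> simp [Matrix.mulVec, dotProduct, Fin.sum_univ_four]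
    have m2 : (Matrix.of ![![1,0,0,0],![0,b,0,0],![0,0,b,0],![0,0,0,1]]).mulVec ![0,0,1,0]
        = b • ![0,0,1,0] := by
      funext i; fin_cases i <;> simp [Matrix.mulVec, dotProduct, Fin.sum_univ_four]
    have m3 : (Matrix.of ![![1,0,0,0],![0,b,0,0],![0,0,b,0],![0,0,0,1]]).mulVec ![0,0,0,1]
        = ![0,0,0,1] := by
      funext i; fin_cases i <;> simp [Matrix.mulVec, dotProduct, Fin.sum_univ_four]
    apply good_base _ (substLin_homog _ _ _ hq)
    · rw [eval_substLin, m0]; exact h0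
    · rw [eval_substLin, m2, hsc, h2, mul_zero]
    · rw [eval_substLin, m3, h3]
    · right
      rw [eval_substLin, eval_substLin, m1, m0, hsc, hb, div_mul_cancel₀ _ h1]

/-- A cubic polynomial with nonzero leading coefficient has a root. -/
lemma cubic_root (a b c d : k) (ha : a ≠ 0) : ∃ w : k, a * w ^ 3 + b * w ^ 2 + c * w + d = 0 := by
  obtain ⟨w, hw⟩ := IsAlgClosed.exists_root
    (Polynomial.C a * Polynomial.X ^ 3 + Polynomial.C b * Polynomial.X ^ 2
      + Polynomial.C c * Polynomial.X + Polynomial.C d)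
    (by rw [Polynomial.degree_cubic ha]; decide)
  exact ⟨w, by simpa [Polynomial.IsRoot] using hw⟩

lemma good_three (q : MvPolynomial (Fin 4) k) (hq : q.IsHomogeneous 3)
    (h0 : eval ![1,0,0,0] q ≠ 0) (h2 : eval ![0,0,1,0] q = 0) : Good q := by
  obtain ⟨w, hw⟩ : ∃ w : k, eval ![w,0,0,1] q = 0 := by
    obtain ⟨c, hc⟩ := cubic_expand q hq
    have e0 : eval ![1,0,0,0] q = c 0 0 0 := by rw [hc]; simp [Fin.sum_univ_four]
    rw [e0] at h0
    obtain ⟨w, hw⟩ := cubic_root (c 0 0 0) (c 0 0 3 + c 0 3 0 + c 3 0 0)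
      (c 0 3 3 + c 3 0 3 + c 3 3 0) (c 3 3 3) h0
    refine ⟨w, ?_⟩
    refine Eq.trans ?_ hw
    rw [hc]
    simp [Fin.sum_univ_four]
    ring
  apply Good.of_subst q (Matrix.of ![![1,0,0,w],![0,1,0,0],![0,-w,1,0],![0,0,0,1]]) 1 one_ne_zero
  · simp [Matrix.det_succ_row_zero, Fin.sum_univ_succ, Fin.succAbove]
  · simp [substLin, Q, Fin.sum_univ_four]
    ring
  · apply good_scale _ (substLin_homog _ _ _ hq)
    · rw [eval_substLin]
      convert h0 using 3
      funext i; fin_cases i <;> simp [Matrix.mulVec, dotProduct, Fin.sum_univ_four]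
    · rw [eval_substLin]
      refine Eq.trans ?_ h2
      congr 2
      funext i; fin_cases i <;> simp [Matrix.mulVec, dotProduct, Fin.sum_univ_four]
    · rw [eval_substLin]
      refine Eq.trans ?_ hw
      congr 2
      funext i; fin_cases i <;> simp [Matrix.mulVec, dotProduct, Fin.sum_univ_four]

lemma good_two (q : MvPolynomial (Fin 4) k) (hq : q.IsHomogeneous 3)
    (h0 : eval ![1,0,0,0] q ≠ 0) : Good q := by
  obtain ⟨w, hw⟩ : ∃ w : k, eval ![w,0,1,0] q = 0 := by
    obtain ⟨c, hc⟩ := cubic_expand q hq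
    have e0 : eval ![1,0,0,0] q = c 0 0 0 := by rw [hc]; simp [Fin.sum_univ_four]
    rw [e0] at h0
    obtain ⟨w, hw⟩ := cubic_root (c 0 0 0) (c 0 0 2 + c 0 2 0 + c 2 0 0)
      (c 0 2 2 + c 2 0 2 + c 2 2 0) (c 2 2 2) h0
    refine ⟨w, ?_⟩
    refine Eq.trans ?_ hw
    rw [hc]
    simp [Fin.sum_univ_four]
    ring
  apply Good.of_subst q (Matrix.of ![![1,0,w,0],![0,1,0,0],![0,0,1,0],![0,-w,0,1]]) 1 one_ne_zero
  · simp [Matrix.det_succ_row_zero, Fin.sum_univ_succ, Fin.succAbove]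
  · simp [substLin, Q, Fin.sum_univ_four]
    ring
  · apply good_three _ (substLin_homog _ _ _ hq)
    · rw [eval_substLin]
      convert h0 using 3
      funext i; fin_cases i <;> simp [Matrix.mulVec, dotProduct, Fin.sum_univ_four]
    · rw [eval_substLin]
      refine Eq.trans ?_ hw
      congr 2
      funext i; fin_cases i <;> simp [Matrix.mulVec, dotProduct, Fin.sum_univ_four]

lemma good_of_z (q : MvPolynomial (Fin 4) k) (hq : q.IsHomogeneous 3) (z : k)
    (h0 : eval ![1,0,z,0] q ≠ 0) : Good q := by
  apply Good.of_subst q (Matrix.of ![![1,0,0,0],![0,1,0,-z],![z,0,1,0],![0,0,0,1]]) 1 one_ne_zero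
  · simp [Matrix.det_succ_row_zero, Fin.sum_univ_succ, Fin.succAbove]
  · simp [substLin, Q, Fin.sum_univ_four]
    ring
  · apply good_two _ (substLin_homog _ _ _ hq)
    rw [eval_substLin]
    convert h0 using 3
    funext i; fin_cases i <;> simp [Matrix.mulVec, dotProduct, Fin.sum_univ_four]

lemma good_of_t (q : MvPolynomial (Fin 4) k) (hq : q.IsHomogeneous 3) (z : k)
    (h0 : eval ![1,0,0,z] q ≠ 0) : Good q := by
  apply Good.of_subst q (Matrix.of ![![1,0,0,0],![0,1,-z,0],![0,0,1,0],![z,0,0,1]]) 1 one_ne_zero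
  · simp [Matrix.det_succ_row_zero, Fin.sum_univ_succ, Fin.succAbove]
  · simp [substLin, Q, Fin.sum_univ_four]
    ring
  · apply good_two _ (substLin_homog _ _ _ hq)
    rw [eval_substLin]
    convert h0 using 3
    funext i; fin_cases i <;> simp [Matrix.mulVec, dotProduct, Fin.sum_univ_four]

lemma lin_coeff_zero (a b c d : k) (h : ∀ w : k, a * w ^ 3 + b * w ^ 2 + c * w + d = 0) :
    c = 0 := by
  have : Infinite k := IsAlgClosed.instInfinite
  have hp : (Polynomial.C a * Polynomial.X ^ 3 + Polynomial.C b * Polynomial.X ^ 2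
      + Polynomial.C c * Polynomial.X + Polynomial.C d) = 0 := by
    apply Polynomial.funext
    intro w
    simpa using h w
  have := congrArg (fun p => Polynomial.coeff p 1) hp
  simpa [Polynomial.coeff_X, Polynomial.coeff_C] using this

lemma exists_point (q : MvPolynomial (Fin 4) k) (hq : q.IsHomogeneous 3)
    (hz : ∀ z : k, eval ![1,0,z,0] q = 0) (ht : ∀ z : k, eval ![1,0,0,z] q = 0) :
    (jacMat k (Q k) q ![1,0,0,0]).rank ≤ 1 := by
  obtain ⟨c, hc⟩ := cubic_expand q hq
  have e0 : c 0 0 0 = 0 := by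
    have := hz 0
    rw [hc] at this
    simpa [Fin.sum_univ_four] using this
  have e2 : c 0 0 2 + c 0 2 0 + c 2 0 0 = 0 := by
    apply lin_coeff_zero (c 2 2 2) (c 0 2 2 + c 2 0 2 + c 2 2 0) _ (c 0 0 0)
    intro w
    rw [← hz w, hc]
    simp [Fin.sum_univ_four]
    ring
  have e3 : c 0 0 3 + c 0 3 0 + c 3 0 0 = 0 := by
    apply lin_coeff_zero (c 3 3 3) (c 0 3 3 + c 3 0 3 + c 3 3 0) _ (c 0 0 0)
    intro w
    rw [← ht w, hc]
    simp [Fin.sum_univ_four]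
    ring
  have : jacMat k (Q k) q ![1,0,0,0]
      = Matrix.vecMulVec ![1, eval ![1,0,0,0] (pderiv 1 q)] ![0,1,0,0] := by
    ext i j
    fin_cases i
    · fin_cases j <;> simp [jacMat, Q, Matrix.vecMulVec, pderiv_X, Pi.single_apply]
    · fin_cases j
      · simp [jacMat, Matrix.vecMulVec]
        rw [hc]
        simp [Fin.sum_univ_four, pderiv_X, Pi.single_apply, e0]
      · simp [jacMat, Matrix.vecMulVec]
      · simp [jacMat, Matrix.vecMulVec]
        rw [hc]
        simp [Fin.sum_univ_four, pderiv_X, Pi.single_apply]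
        linear_combination e2
      · simp [jacMat, Matrix.vecMulVec]
        rw [hc]
        simp [Fin.sum_univ_four, pderiv_X, Pi.single_apply]
        linear_combination e3
  rw [this]
  exact Matrix.rank_vecMulVec_le _ _

end Stmt8Aux

theorem stmt8 (k : Type*) [Field k] [IsAlgClosed k] [CharP k 2]
    (f : MvPolynomial (Fin 4) k) (hf : f = X 0 * X 1 + X 2 * X 3)
    (q0 : MvPolynomial (Fin 4) k) (hq0 : q0.IsHomogeneous 3)
    (hsmooth : ∀ p : Fin 4 → k, p ≠ 0 →
      MvPolynomial.eval p f = 0 → MvPolynomial.eval p q0 = 0 →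
      (jacMat k f q0 p).rank = 2) :
    ∃ (A : Matrix.GeneralLinearGroup (Fin 4) k) (c lam : kˣ)
      (L : MvPolynomial (Fin 4) k), L.IsHomogeneous 1 ∧
      substLin k (A : Matrix (Fin 4) (Fin 4) k) f = C (c : k) * f ∧
      ∃ a21 a31 a20 a12 a22 a11 a32 a10 a13 a02 a23 a01 : k,
        (substLin k (A : Matrix (Fin 4) (Fin 4) k) q0 =
            C (lam : k) * cubicA k a21 a31 a20 a12 a22 a11 a32 a10 a13 a02 a23 a01 + L * f ∨
         substLin k (A : Matrix (Fin 4) (Fin 4) k) q0 =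
            C (lam : k) * cubicB k a21 a31 a20 a12 a22 a11 a32 a10 a13 a02 a23 a01 + L * f) := by
  have hfQ : f = Stmt8Aux.Q k := hf
  subst hfQ
  change Stmt8Aux.Good q0
  by_cases hz : ∀ z : k, eval ![1,0,z,0] q0 = 0
  · by_cases ht : ∀ z : k, eval ![1,0,0,z] q0 = 0
    · exfalso
      have h1 := Stmt8Aux.exists_point q0 hq0 hz ht
      have h2 := hsmooth ![1,0,0,0] (fun h => by simpa using congrFun h 0)
        (by simp [Stmt8Aux.Q]) (hz 0)
      omega
    · push Not at ht
      obtain ⟨z, h⟩ := ht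
      exact Stmt8Aux.good_of_t q0 hq0 z h
  · push Not at hz
    obtain ⟨z, h⟩ := hz
    exact Stmt8Aux.good_of_z q0 hq0 z h
end
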